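/- Carathéodory–Toeplitz (Vandermonde decomposition): Let T ∈ ℂ^{N×N} be a Hermitian positive semidefinite Toeplitz matrix (i.e., T_{m,n} depends only on m − n) of rank K < N. Then there exist K distinct frequencies φ_1, …, φ_K ∈ [0, 1) and positive reals p_1, …, p_K > 0 such that T = Σ_{k=1}^K p_k d(φ_k) d(φ_k)^H, where [d(φ)]_n = exp(j 2π (n−1) φ) for n = 1, …, N. -/

import Mathlib

open Real Matrix ComplexOrder

/-- The far-field steering vector `d(φ) ∈ ℂ^N`, `[d(φ)]ₙ = exp(j2π(n−1)φ)`
(zero-based index). -/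
noncomputable def dvec (N : ℕ) (φ : ℝ) : Fin N → ℂ :=
  fun n => Complex.exp (Complex.I * (2 * Real.pi * (n : ℝ) * φ))

/-- A matrix is Toeplitz if its entries depend only on the difference of the
indices, i.e. `T_{m+1,n+1} = T_{m,n}`. -/
def IsToeplitz {N : ℕ} (T : Matrix (Fin N) (Fin N) ℂ) : Prop :=
  ∀ (i j : ℕ) (h1 : i + 1 < N) (h2 : j + 1 < N),
    T ⟨i + 1, h1⟩ ⟨j + 1, h2⟩ = T ⟨i, by omega⟩ ⟨j, by omega⟩

open Module

/-- Gram-equal families are related by an isometry of the ambient space. -/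
lemma ct_exists_isometry {H : Type*} [NormedAddCommGroup H] [InnerProductSpace ℂ H]
    [FiniteDimensional ℂ H] {n : ℕ} (a b : Fin n → H)
    (hab : ∀ i j, inner ℂ (a i) (a j) = inner ℂ (b i) (b j)) :
    ∃ U : H →ₗᵢ[ℂ] H, ∀ i, U (a i) = b i := by
  let f : (Fin n → ℂ) →ₗ[ℂ] H := Fintype.linearCombination ℂ a
  let g : (Fin n → ℂ) →ₗ[ℂ] H := Fintype.linearCombination ℂ b
  have hn : ∀ x, ‖g x‖ = ‖f x‖ := by
    intro x
    have h : inner ℂ (g x) (g x) = inner ℂ (f x) (f x) := by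
      simp only [f, g, Fintype.linearCombination_apply, sum_inner, inner_sum, inner_smul_left,
        inner_smul_right, hab]
    rw [@norm_eq_sqrt_re_inner ℂ, @norm_eq_sqrt_re_inner ℂ, h]
  obtain ⟨s, hs⟩ := f.rangeRestrict.exists_rightInverse_of_surjective f.range_rangeRestrict
  have hs' : ∀ y : LinearMap.range f, f (s y) = y := fun y =>
    congrArg Subtype.val (LinearMap.congr_fun hs y)
  let L : LinearMap.range f →ₗᵢ[ℂ] H :=
    { toLinearMap := g ∘ₗ s
      norm_map' := fun y => by
        simp only [LinearMap.comp_apply, hn, hs', Submodule.coe_norm] }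
  refine ⟨L.extend, fun i => ?_⟩
  have ha : f (Pi.single i 1) = a i := by simp [f]
  have hb : g (Pi.single i 1) = b i := by simp [g]
  have h1 := L.extend_apply ⟨a i, ⟨_, ha⟩⟩
  change L.extend (a i) = g (s ⟨a i, ⟨_, ha⟩⟩) at h1
  rw [h1, ← hb, ← sub_eq_zero, ← map_sub, ← norm_eq_zero, hn, map_sub, hs', ha, sub_self, norm_zero]

lemma ct_norm_eigen {H : Type*} [NormedAddCommGroup H] [InnerProductSpace ℂ H]
    (U : H →ₗᵢ[ℂ] H) {μ : ℂ} {x : H} (hx : x ≠ 0) (h : U x = μ • x) : ‖μ‖ = 1 := by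
  have h1 := U.norm_map x
  rw [h, norm_smul] at h1
  exact (mul_eq_right₀ (norm_ne_zero_iff.mpr hx)).mp h1

/-- Spectral theorem for linear isometries of a finite-dimensional space. -/
lemma ct_spectral {H : Type*} [NormedAddCommGroup H] [InnerProductSpace ℂ H]
    [FiniteDimensional ℂ H] {K : ℕ} (hK : finrank ℂ H = K) (U : H →ₗᵢ[ℂ] H) :
    ∃ (e : OrthonormalBasis (Fin K) ℂ H) (l : Fin K → ℂ),
      (∀ k, ‖l k‖ = 1) ∧ ∀ k, U (e k) = l k • e k := by
  classical
  let T : End ℂ H := U.toLinearMap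
  have hss : T.IsSemisimple := by
    rw [Module.End.isSemisimple_iff]
    intro p hp
    refine ⟨pᗮ, ?_, Submodule.isCompl_orthogonal p⟩
    have hmap : p.map T = p := by
      apply Submodule.eq_of_le_of_finrank_eq
      · rwa [Submodule.map_le_iff_le_comap]
      · exact (Submodule.equivMapOfInjective T U.injective p).finrank_eq.symm
    rw [Module.End.mem_invtSubmodule]
    intro x hx
    rw [Submodule.mem_comap, Submodule.mem_orthogonal]
    intro y hy
    rw [← hmap] at hy
    obtain ⟨z, hz, rfl⟩ := hy
    exact (U.inner_map_map z x).trans ((Submodule.mem_orthogonal _ _).1 hx z hz)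
  have hort : OrthogonalFamily ℂ (fun μ : T.Eigenvalues => T.eigenspace μ)
      fun μ => (T.eigenspace μ).subtypeₗᵢ := by
    intro μ ν hne x y
    by_cases hx : (x : H) = 0
    · simp [hx]
    have hUx : U (x : H) = (μ : ℂ) • (x : H) := Module.End.mem_eigenspace_iff.1 x.2
    have hUy : U (y : H) = (ν : ℂ) • (y : H) := Module.End.mem_eigenspace_iff.1 y.2
    have h1 := U.inner_map_map (x : H) (y : H)
    rw [hUx, hUy, inner_smul_left, inner_smul_right] at h1
    have hμ := ct_norm_eigen U hx hUx
    have hμ' : (μ : ℂ) * (starRingEnd ℂ) (μ : ℂ) = 1 := by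
      rw [Complex.mul_conj, Complex.normSq_eq_norm_sq, hμ]; simp
    by_contra hxy
    change ¬ inner ℂ (x : H) (y : H) = 0 at hxy
    have h2 : (starRingEnd ℂ) (μ : ℂ) * (ν : ℂ) = 1 := by
      apply mul_right_cancel₀ hxy
      rw [one_mul, mul_assoc, h1]
    apply hne
    apply Subtype.ext
    calc (μ : ℂ) = μ * ((starRingEnd ℂ) (μ : ℂ) * (ν : ℂ)) := by rw [h2, mul_one]
      _ = ν := by rw [← mul_assoc, hμ', one_mul]
  have hinternal : DirectSum.IsInternal fun μ : T.Eigenvalues => T.eigenspace μ := by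
    rw [hort.isInternal_iff, Submodule.orthogonal_eq_bot_iff]
    rw [← hss.iSup_eigenspace_eq_top]
    apply le_antisymm
    · exact iSup_le fun μ => le_iSup (fun μ => T.eigenspace μ) (μ : ℂ)
    · refine iSup_le fun μ => ?_
      by_cases h : T.HasEigenvalue μ
      · exact le_iSup (fun μ : T.Eigenvalues => T.eigenspace μ) ⟨μ, h⟩
      · have : T.eigenspace μ = ⊥ := by
          by_contra h'
          exact h (Module.End.hasEigenvalue_iff.2 h')
        rw [this]; exact bot_le
  let e := hinternal.subordinateOrthonormalBasis hK hort
  let l : Fin K → ℂ := fun k => (hinternal.subordinateOrthonormalBasisIndex hK k hort).val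
  have he : ∀ k, U (e k) = l k • e k := fun k =>
    Module.End.mem_eigenspace_iff.1 (hinternal.subordinateOrthonormalBasis_subordinate hK k hort)
  exact ⟨e, l, fun k => ct_norm_eigen U (e.orthonormal.ne_zero k) (he k), he⟩

/-- A unit complex number is the conjugate of some `exp (2 π i φ)`. -/
lemma ct_freq (z : ℂ) (hz : ‖z‖ = 1) :
    ∃ φ : ℝ, φ ∈ Set.Ico (0 : ℝ) 1 ∧
      (starRingEnd ℂ) z = Complex.exp (Complex.I * (2 * Real.pi * φ)) := by
  let w := (starRingEnd ℂ) z
  have hw : ‖w‖ = 1 := by simp [w, hz]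
  refine ⟨Int.fract (w.arg / (2 * Real.pi)), ⟨Int.fract_nonneg _, Int.fract_lt_one _⟩, ?_⟩
  change w = _
  have h1 : w = Complex.exp (w.arg * Complex.I) := by
    have := Complex.norm_mul_exp_arg_mul_I w
    rw [hw] at this
    simpa using this.symm
  conv_lhs => rw [h1]
  rw [Complex.exp_eq_exp_iff_exists_int]
  refine ⟨⌊w.arg / (2 * Real.pi)⌋, ?_⟩
  have hpi : (Real.pi : ℂ) ≠ 0 := by exact_mod_cast Real.pi_ne_zero
  rw [Int.fract]
  push_cast
  field_simp
  ring

lemma ct_dvec (N : ℕ) (φ : ℝ) (n : Fin N) :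
    dvec N φ n = Complex.exp (Complex.I * (2 * Real.pi * φ)) ^ (n : ℕ) := by
  rw [dvec, ← Complex.exp_nat_mul]
  congr 1
  push_cast
  ring

/-- The decomposition for Gram matrices of spanning families. -/
lemma ct_gram {H : Type*} [NormedAddCommGroup H] [InnerProductSpace ℂ H]
    [FiniteDimensional ℂ H] {N K : ℕ} (hK : finrank ℂ H = K) (T : Matrix (Fin N) (Fin N) ℂ)
    (htoe : IsToeplitz T) (hN : 0 < N) (v : Fin N → H)
    (hT : ∀ i j, T i j = inner ℂ (v i) (v j))
    (hspan : Submodule.span ℂ (Set.range v) = ⊤) :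
    ∃ (φ : Fin K → ℝ) (p : Fin K → ℝ), Function.Injective φ ∧
      (∀ k, φ k ∈ Set.Ico (0 : ℝ) 1) ∧ (∀ k, 0 < p k) ∧
      T = ∑ k, (p k : ℂ) •
        Matrix.of (fun m n => dvec N (φ k) m * star (dvec N (φ k) n)) := by
  obtain ⟨M, rfl⟩ : ∃ M, N = M + 1 := ⟨N - 1, by omega⟩
  obtain ⟨U, hU⟩ := ct_exists_isometry (fun i : Fin M => v i.castSucc) (fun i : Fin M => v i.succ)
    (fun i j => by
      rw [← hT, ← hT]
      exact (htoe i j (by omega) (by omega)).symm)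
  obtain ⟨e, l, hl, he⟩ := ct_spectral hK U
  choose φ hφ hlφ using fun k => ct_freq (l k) (hl k)
  have hll : ∀ k, (starRingEnd ℂ) (l k) * l k = 1 := fun k => by
    rw [mul_comm, Complex.mul_conj, Complex.normSq_eq_norm_sq, hl]; simp
  -- coordinates
  have hUe : ∀ k x, inner ℂ (e k) (U x) = l k * inner ℂ (e k) x := by
    intro k x
    have h1 := U.inner_map_map (e k) x
    rw [he, inner_smul_left] at h1
    rw [← h1, ← mul_assoc, mul_comm (l k), hll, one_mul]
  have hc : ∀ k (i : Fin (M + 1)), inner ℂ (e k) (v i) = l k ^ (i : ℕ) * inner ℂ (e k) (v 0) := by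
    intro k i
    induction i using Fin.induction with
    | zero => simp
    | succ i ih =>
      have := hU i
      rw [← this, hUe, ih, Fin.val_succ, pow_succ, Fin.val_castSucc]
      ring
  have hzero : ∀ x : H, (∀ i, inner ℂ x (v i) = 0) → x = 0 := by
    intro x hx
    have : x ∈ (Submodule.span ℂ (Set.range v))ᗮ := by
      rw [Submodule.mem_orthogonal']
      intro u hu
      induction hu using Submodule.span_induction with
      | mem y hy => obtain ⟨i, rfl⟩ := hy; exact hx i
      | zero => simp
      | add y z _ _ hy hz => rw [inner_add_right, hy, hz, add_zero]
      | smul a y _ hy => rw [inner_smul_right, hy, mul_zero]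
    rw [hspan, Submodule.top_orthogonal_eq_bot] at this
    simpa using this
  have hne : ∀ k, inner ℂ (e k) (v 0) ≠ 0 := by
    intro k h
    exact e.orthonormal.ne_zero k (hzero _ fun i => by rw [hc, h, mul_zero])
  refine ⟨φ, fun k => ‖inner ℂ (e k) (v 0)‖ ^ 2, ?_, hφ, fun k => by
    have := norm_pos_iff.2 (hne k)
    positivity, ?_⟩
  · intro a b hab
    by_contra hab'
    have hlab : l a = l b := by
      have : (starRingEnd ℂ) (l a) = (starRingEnd ℂ) (l b) := by rw [hlφ, hlφ, hab]
      exact (starRingEnd ℂ).injective this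
    let x : H := (starRingEnd ℂ) (inner ℂ (e b) (v 0)) • e a -
      (starRingEnd ℂ) (inner ℂ (e a) (v 0)) • e b
    have hx : x = 0 := hzero x fun i => by
      simp only [x, inner_sub_left, inner_smul_left, hc a i, hc b i, hlab, Complex.conj_conj]
      ring
    have h1 : inner ℂ (e a) x = (starRingEnd ℂ) (inner ℂ (e b) (v 0)) := by
      have h2 : inner ℂ (e a) (e b) = 0 := e.orthonormal.2 hab'
      have h3 : inner ℂ (e a) (e a) = (1 : ℂ) := by
        rw [inner_self_eq_norm_sq_to_K, e.orthonormal.1]; simp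
      simp only [x, inner_sub_right, inner_smul_right, h2, h3]
      simp
    rw [hx, inner_zero_right] at h1
    exact hne b ((map_eq_zero _).1 h1.symm)
  · ext i j
    rw [hT, ← e.sum_inner_mul_inner, Matrix.sum_apply]
    refine Finset.sum_congr rfl fun k _ => ?_
    rw [← inner_conj_symm (v i) (e k), hc k i, hc k j, Matrix.smul_apply, Matrix.of_apply,
      ct_dvec, ct_dvec, ← hlφ]
    have h3 := Complex.mul_conj (inner ℂ (e k) (v 0))
    rw [Complex.normSq_eq_norm_sq] at h3
    rw [← h3]
    simp only [smul_eq_mul, map_mul, map_pow, star_pow, RCLike.star_def, Complex.conj_conj]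
    ring

/-- **Carathéodory–Toeplitz / Vandermonde decomposition.**
A Hermitian positive semidefinite Toeplitz matrix `T ∈ ℂ^{N×N}` of rank
`K < N` decomposes as `T = Σ_{k=1}^K p_k d(φ_k) d(φ_k)ᴴ` for `K` distinct
frequencies `φ_k ∈ [0,1)` and positive weights `p_k > 0`. -/
theorem caratheodory_toeplitz (N K : ℕ) (T : Matrix (Fin N) (Fin N) ℂ)
    (hpsd : T.PosSemidef) (htoe : IsToeplitz T) (hrank : T.rank = K) (hK : K < N) :
    ∃ (φ : Fin K → ℝ) (p : Fin K → ℝ), Function.Injective φ ∧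
      (∀ k, φ k ∈ Set.Ico (0 : ℝ) 1) ∧ (∀ k, 0 < p k) ∧
      T = ∑ k, (p k : ℂ) •
        Matrix.of (fun m n => dvec N (φ k) m * star (dvec N (φ k) n)) := by
  obtain ⟨m, w, hw⟩ := Matrix.posSemidef_iff_eq_sum_vecMulVec.mp hpsd
  let B : Matrix (Fin m) (Fin N) ℂ := Matrix.of fun i j => star (w i j)
  have hB : T = Bᴴ * B := by
    ext i j
    rw [hw, Matrix.sum_apply, Matrix.mul_apply]
    refine Finset.sum_congr rfl fun k _ => ?_
    simp [B, Matrix.vecMulVec_apply]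
  let u : Fin N → EuclideanSpace ℂ (Fin m) := fun j => WithLp.toLp 2 (B.col j)
  let S := Submodule.span ℂ (Set.range u)
  let v : Fin N → S := fun j => ⟨u j, Submodule.subset_span ⟨j, rfl⟩⟩
  refine ct_gram (H := S) ?_ T htoe (by omega) v ?_ ?_
  · rw [← hrank, hB, Matrix.rank_conjTranspose_mul_self, Matrix.rank_eq_finrank_span_cols]
    have : S = (Submodule.span ℂ (Set.range B.col)).map
        (WithLp.linearEquiv 2 ℂ (Fin m → ℂ)).symm.toLinearMap := by
      rw [Submodule.map_span, ← Set.range_comp]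
      rfl
    rw [this]
    exact LinearEquiv.finrank_map_eq _ _
  · intro i j
    rw [hB, Matrix.mul_apply]
    change _ = inner ℂ (u i) (u j)
    simp [u, PiLp.inner_apply, mul_comm]
  · have : Set.range v = Subtype.val ⁻¹' (Set.range u) := by
      ext x
      simp [v, Subtype.ext_iff]
    rw [this]
    exact Submodule.span_span_coe_preimage
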